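/- Let e ≥ 1. In the polynomial ring R = ℂ[y_0,…,y_e], for 0 ≤ m ≤ 2e set c_m = Σ_{i+j=m, 0≤i,j≤e} y_i y_j, let Q_e ⊆ R be the ℂ-subalgebra generated by c_0,…,c_{2e}, and let V_e ⊆ R be the degree-2 Veronese subalgebra generated by all products y_i y_j (0 ≤ i ≤ j ≤ e). Then V_e is the integral closure of Q_e in its field of fractions; precisely: (i) every element of V_e is integral over Q_e; (ii) Q_e and V_e have the same field of fractions (as subfields of Frac(R)); and (iii) V_e is integrally closed in its field of fractions. In particular, the Veronese ring V_e is the normalization of Q_e, and V_e is a finite Q_e-module of generic rank 1. -/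

import Mathlib

/-!
Statement 6 (paper's Lemma "single normalization"):
In `R = ℂ[y₀,…,y_e]`, with `c_m = Σ_{i+j=m} y_i y_j`, `Q_e` the subalgebra generated by
`c_0, …, c_{2e}`, and `V_e` the degree-2 Veronese subalgebra (generated by all products
`y_i y_j`), the Veronese ring `V_e` is the integral closure of `Q_e` in its field of
fractions: (i) every element of `V_e` is integral over `Q_e`; (ii) `Q_e` and `V_e` have
the same field of fractions inside `Frac(R)`; (iii) `V_e` is integrally closed in its
field of fractions.  In particular `V_e` is the normalization of `Q_e` and is a finite
`Q_e`-module of generic rank `1`.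
-/

noncomputable section

/-- The variable `y_i` of `ℂ[y₀,…,y_e]` (and `0` if `i > e`). -/
def yVar (e i : ℕ) : MvPolynomial (Fin (e + 1)) ℂ :=
  if h : i ≤ e then MvPolynomial.X ⟨i, Nat.lt_succ_of_le h⟩ else 0

/-- `c_m = Σ_{i+j=m, 0 ≤ i,j ≤ e} y_i y_j`. -/
def cCoeff (e m : ℕ) : MvPolynomial (Fin (e + 1)) ℂ :=
  ∑ p ∈ Finset.HasAntidiagonal.antidiagonal m, yVar e p.1 * yVar e p.2

/-- `Q_e`: the subalgebra of `ℂ[y₀,…,y_e]` generated by `c_0, …, c_{2e}`. -/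
def Qe (e : ℕ) : Subalgebra ℂ (MvPolynomial (Fin (e + 1)) ℂ) :=
  Algebra.adjoin ℂ ((fun m => cCoeff e m) '' {m : ℕ | m ≤ 2 * e})

/-- `V_e`: the degree-2 Veronese subalgebra of `ℂ[y₀,…,y_e]`, generated by all
products of two variables. -/
def Ve (e : ℕ) : Subalgebra ℂ (MvPolynomial (Fin (e + 1)) ℂ) :=
  Algebra.adjoin ℂ
    {x | ∃ i j : Fin (e + 1), x = MvPolynomial.X i * MvPolynomial.X j}

lemma yVar_val (e : ℕ) (i : Fin (e + 1)) : yVar e i = MvPolynomial.X i := by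
  simp [yVar, Nat.le_of_lt_succ i.2]

lemma yVar_of_lt {e i : ℕ} (h : e < i) : yVar e i = 0 := by
  simp [yVar, Nat.not_le.mpr h]

lemma cCoeff_mem_Qe (e m : ℕ) : cCoeff e m ∈ Qe e := by
  by_cases h : m ≤ 2 * e
  · exact Algebra.subset_adjoin ⟨m, h, rfl⟩
  · have h0 : cCoeff e m = 0 := by
      refine Finset.sum_eq_zero fun p hp => ?_
      rw [Finset.HasAntidiagonal.mem_antidiagonal] at hp
      rcases (by omega : e < p.1 ∨ e < p.2) with h1 | h1 <;> simp [yVar_of_lt h1]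
    rw [h0]
    exact zero_mem _

lemma yVar_mul_mem_Ve (e i j : ℕ) : yVar e i * yVar e j ∈ Ve e := by
  by_cases hi : i ≤ e
  · by_cases hj : j ≤ e
    · exact Algebra.subset_adjoin
        ⟨⟨i, by omega⟩, ⟨j, by omega⟩, by simp [yVar, hi, hj]⟩
    · rw [yVar_of_lt (not_le.mp hj), mul_zero]
      exact zero_mem _
  · rw [yVar_of_lt (not_le.mp hi), zero_mul]
    exact zero_mem _

lemma Qe_le_Ve (e : ℕ) : Qe e ≤ Ve e := by
  refine Algebra.adjoin_le ?_
  rintro _ ⟨m, -, rfl⟩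
  exact sum_mem fun p _ => yVar_mul_mem_Ve e _ _

/-- The polynomial `∑ yᵢ λⁱ`, whose square has coefficients `c_m`. -/
def yPoly (e : ℕ) : Polynomial (MvPolynomial (Fin (e + 1)) ℂ) :=
  ∑ i ∈ Finset.range (e + 1), Polynomial.monomial i (yVar e i)

lemma yPoly_coeff (e i : ℕ) : (yPoly e).coeff i = yVar e i := by
  simp only [yPoly, Polynomial.finsetSum_coeff, Polynomial.coeff_monomial,
    Finset.sum_ite_eq', Finset.mem_range]
  split_ifs with h
  · rfl
  · exact (yVar_of_lt (by omega)).symm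

lemma yPoly_sq_coeff (e m : ℕ) : (yPoly e ^ 2).coeff m = cCoeff e m := by
  simp only [sq, Polynomial.coeff_mul, yPoly_coeff, cCoeff]

lemma isIntegral_X (e : ℕ) (i : Fin (e + 1)) :
    IsIntegral (Qe e) (MvPolynomial.X i : MvPolynomial (Fin (e + 1)) ℂ) := by
  let _ := Polynomial.algebra (Qe e) (MvPolynomial (Fin (e + 1)) ℂ)
  have hsq : IsIntegral (Polynomial (Qe e)) (yPoly e ^ 2) :=
    Polynomial.isIntegral_iff_isIntegral_coeff.mpr fun m => by
      rw [yPoly_sq_coeff]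
      exact isIntegral_algebraMap (R := Qe e) (x := ⟨_, cCoeff_mem_Qe e m⟩)
  have h := Polynomial.isIntegral_iff_isIntegral_coeff.mp (hsq.of_pow two_pos) i
  rwa [yPoly_coeff, yVar_val] at h

lemma isIntegral_Qe (e : ℕ) (x : MvPolynomial (Fin (e + 1)) ℂ) : IsIntegral (Qe e) x := by
  induction x using MvPolynomial.induction_on with
  | C a => exact isIntegral_algebraMap (R := Qe e) (x := algebraMap ℂ (Qe e) a)
  | add p q hp hq => exact hp.add hq
  | mul_X p i hp => exact hp.mul (isIntegral_X e i)

/-- The sign involution `yᵢ ↦ -yᵢ`. -/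
def negVars (e : ℕ) : MvPolynomial (Fin (e + 1)) ℂ →ₐ[ℂ] MvPolynomial (Fin (e + 1)) ℂ :=
  MvPolynomial.aeval fun i => -MvPolynomial.X i

lemma negVars_eq_of_mem_Ve {e : ℕ} {x : MvPolynomial (Fin (e + 1)) ℂ} (hx : x ∈ Ve e) :
    negVars e x = x := by
  have h : Ve e ≤ AlgHom.equalizer (negVars e) (AlgHom.id ℂ _) := by
    refine Algebra.adjoin_le ?_
    rintro _ ⟨i, j, rfl⟩
    simp [negVars]
  exact h hx

lemma symmetrization_mem_Ve (e : ℕ) (r : MvPolynomial (Fin (e + 1)) ℂ) :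
    r + negVars e r ∈ Ve e ∧ ∀ j, MvPolynomial.X j * (r - negVars e r) ∈ Ve e := by
  induction r using MvPolynomial.induction_on with
  | C a =>
    have ha : negVars e (MvPolynomial.C a) = MvPolynomial.C a := (negVars e).commutes a
    have hV : MvPolynomial.C a ∈ Ve e := (Ve e).algebraMap_mem a
    rw [ha]
    exact ⟨add_mem hV hV, fun j => by simp⟩
  | add p q hp hq =>
    refine ⟨?_, fun j => ?_⟩
    · convert add_mem hp.1 hq.1 using 1
      rw [map_add]; ring
    · convert add_mem (hp.2 j) (hq.2 j) using 1
      rw [map_add]; ring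
  | mul_X p i hp =>
    have hs : negVars e (p * MvPolynomial.X i) = -(negVars e p * MvPolynomial.X i) := by
      simp [negVars]
    rw [hs]
    refine ⟨?_, fun j => ?_⟩
    · convert hp.2 i using 1
      ring
    · have hij : MvPolynomial.X i * MvPolynomial.X j ∈ Ve e :=
        Algebra.subset_adjoin ⟨i, j, rfl⟩
      convert mul_mem hij hp.1 using 1
      ring

lemma mem_Ve_of_negVars_eq {e : ℕ} {r : MvPolynomial (Fin (e + 1)) ℂ}
    (h : negVars e r = r) : r ∈ Ve e := by
  have h2 := (Ve e).smul_mem (symmetrization_mem_Ve e r).1 (2⁻¹ : ℂ)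
  rwa [h, ← two_smul ℂ r, smul_smul, inv_mul_cancel₀ two_ne_zero, one_smul] at h2

lemma isIntegrallyClosed_Ve (e : ℕ) : IsIntegrallyClosed (Ve e) := by
  let R := MvPolynomial (Fin (e + 1)) ℂ
  rw [isIntegrallyClosed_iff (FractionRing (Ve e))]
  intro x hx
  have hinj : Function.Injective (algebraMap (Ve e) R) := Subtype.val_injective
  let φ : FractionRing (Ve e) →+* FractionRing R := IsFractionRing.map hinj
  have hφ : ∀ a : Ve e, φ (algebraMap _ _ a) = algebraMap R (FractionRing R) a := fun a =>
    IsLocalization.map_eq _ a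
  have hφx : IsIntegral R (φ x) :=
    hx.map_of_comp_eq (algebraMap (Ve e) R) φ (RingHom.ext fun a => (hφ a).symm)
  obtain ⟨r, hr⟩ := IsIntegrallyClosed.isIntegral_iff.mp hφx
  obtain ⟨a, b, hb, rfl⟩ := IsFractionRing.div_surjective (A := Ve e) x
  have hb0 : (b : R) ≠ 0 := fun h => nonZeroDivisors.ne_zero hb (Subtype.ext h)
  have hab : r * (b : R) = a := by
    apply IsFractionRing.injective R (FractionRing R)
    have hb' : algebraMap R (FractionRing R) b ≠ 0 := by
      simpa using hb0
    rw [map_mul, hr, map_div₀, hφ, hφ, div_mul_cancel₀ _ hb']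
  have hrV : r ∈ Ve e := by
    apply mem_Ve_of_negVars_eq
    apply mul_right_cancel₀ hb0
    rw [hab, ← negVars_eq_of_mem_Ve b.2, ← map_mul, hab, negVars_eq_of_mem_Ve a.2]
  refine ⟨⟨r, hrV⟩, ?_⟩
  apply φ.injective
  rw [hφ, hr]

lemma subfieldClosure_Qe_eq (e : ℕ) :
    Subfield.closure
        ((algebraMap (MvPolynomial (Fin (e + 1)) ℂ)
            (FractionRing (MvPolynomial (Fin (e + 1)) ℂ))) ''
          (Qe e : Set (MvPolynomial (Fin (e + 1)) ℂ)))
      = Subfield.closure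
        ((algebraMap (MvPolynomial (Fin (e + 1)) ℂ)
            (FractionRing (MvPolynomial (Fin (e + 1)) ℂ))) ''
          (Ve e : Set (MvPolynomial (Fin (e + 1)) ℂ))) := by
  refine le_antisymm (Subfield.closure_mono (Set.image_mono (Qe_le_Ve e))) ?_
  set ι := algebraMap (MvPolynomial (Fin (e + 1)) ℂ)
    (FractionRing (MvPolynomial (Fin (e + 1)) ℂ))
  set F := Subfield.closure (ι '' (Qe e : Set (MvPolynomial (Fin (e + 1)) ℂ)))
  have hQ : ∀ x ∈ Qe e, ι x ∈ F := fun x hx => Subfield.subset_closure ⟨x, hx, rfl⟩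
  have h0 : ι (yVar e 0) ≠ 0 := by
    have : yVar e 0 = MvPolynomial.X 0 := yVar_val e 0
    rw [this]
    simp [ι]
  have hc : ∀ m, ι (cCoeff e m) ∈ F := fun m => hQ _ (cCoeff_mem_Qe e m)
  have h00 : ι (yVar e 0) * ι (yVar e 0) ∈ F := by
    simpa [cCoeff] using hc 0
  have hdiv : ∀ i j, ι (yVar e 0) * ι (yVar e i) ∈ F → ι (yVar e 0) * ι (yVar e j) ∈ F →
      ι (yVar e i) * ι (yVar e j) ∈ F := by
    intro i j hi hj
    convert div_mem (mul_mem hi hj) h00 using 1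
    field_simp
  have key : ∀ m, ι (yVar e 0) * ι (yVar e m) ∈ F := by
    intro m
    induction m using Nat.strong_induction_on with
    | _ m ih =>
      obtain _ | _ | m := m
      · exact h00
      · have h := hc 1
        have h2 := div_mem h (ofNat_mem F 2)
        convert h2 using 1
        simp [cCoeff, Finset.Nat.antidiagonal_succ]
        ring
      · have h := hc (m + 2)
        rw [cCoeff, Finset.Nat.antidiagonal_succ_succ'] at h
        simp only [Finset.sum_cons, Finset.sum_map, map_add, map_sum, map_mul] at h
        have hS : ∑ p ∈ Finset.HasAntidiagonal.antidiagonal m,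
            ι (yVar e (p.1 + 1)) * ι (yVar e (p.2 + 1)) ∈ F := by
          refine sum_mem fun p hp => ?_
          rw [Finset.HasAntidiagonal.mem_antidiagonal] at hp
          exact hdiv _ _ (ih _ (by omega)) (ih _ (by omega))
        convert div_mem (sub_mem h hS) (ofNat_mem F 2) using 1
        simp
        ring
  rw [Subfield.closure_le]
  rintro _ ⟨x, hx, rfl⟩
  change ι x ∈ F
  induction hx using Algebra.adjoin_induction with
  | mem x hx =>
    obtain ⟨i, j, rfl⟩ := hx
    rw [← yVar_val, ← yVar_val, map_mul]
    exact hdiv _ _ (key _) (key _)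
  | algebraMap a => exact hQ _ ((Qe e).algebraMap_mem a)
  | add x y _ _ hx hy => rw [map_add]; exact add_mem hx hy
  | mul x y _ _ hx hy => rw [map_mul]; exact mul_mem hx hy

lemma exists_finset_span_Ve (e : ℕ) :
    ∃ s : Finset (MvPolynomial (Fin (e + 1)) ℂ),
      (↑s : Set (MvPolynomial (Fin (e + 1)) ℂ)) ⊆ (Ve e : Set (MvPolynomial (Fin (e + 1)) ℂ))
      ∧ (Ve e : Set (MvPolynomial (Fin (e + 1)) ℂ)) ⊆
          (Submodule.span ↥(Qe e) (↑s : Set (MvPolynomial (Fin (e + 1)) ℂ)) :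
            Submodule ↥(Qe e) (MvPolynomial (Fin (e + 1)) ℂ)) := by
  set S : Set (MvPolynomial (Fin (e + 1)) ℂ) :=
    {x | ∃ i j : Fin (e + 1), x = MvPolynomial.X i * MvPolynomial.X j}
  have hfin : S.Finite := by
    refine (Set.finite_range fun p : Fin (e + 1) × Fin (e + 1) =>
      (MvPolynomial.X p.1 * MvPolynomial.X p.2 : MvPolynomial (Fin (e + 1)) ℂ)).subset ?_
    rintro _ ⟨i, j, rfl⟩
    exact ⟨(i, j), rfl⟩
  obtain ⟨s, hs⟩ := fg_adjoin_of_finite (R := Qe e) hfin fun x _ => isIntegral_Qe e x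
  refine ⟨s, fun x hx => ?_, fun x hx => ?_⟩
  · have hx' : x ∈ Algebra.adjoin (Qe e) S := by
      rw [← Subalgebra.mem_toSubmodule, ← hs]
      exact Submodule.subset_span hx
    clear hx
    induction hx' using Algebra.adjoin_induction with
    | mem x hx => exact Algebra.subset_adjoin hx
    | algebraMap a => exact Qe_le_Ve e a.2
    | add x y _ _ hx hy => exact add_mem hx hy
    | mul x y _ _ hx hy => exact mul_mem hx hy
  · rw [hs]
    induction hx using Algebra.adjoin_induction with
    | mem x hx => exact Algebra.subset_adjoin hx
    | algebraMap a => exact (Algebra.adjoin (Qe e) S).algebraMap_mem (algebraMap ℂ (Qe e) a)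
    | add x y _ _ hx hy => exact add_mem hx hy
    | mul x y _ _ hx hy => exact Subalgebra.mul_mem _ hx hy

theorem veronese_is_normalization_of_Qe (e : ℕ) (he : 1 ≤ e) :
    -- (i) every element of `V_e` is integral over `Q_e`;
    (∀ x ∈ Ve e, IsIntegral ↥(Qe e) x)
    ∧
    -- (ii) `Q_e` and `V_e` have the same field of fractions inside `Frac(R)`;
    (Subfield.closure
        ((algebraMap (MvPolynomial (Fin (e + 1)) ℂ)
            (FractionRing (MvPolynomial (Fin (e + 1)) ℂ))) ''
          (Qe e : Set (MvPolynomial (Fin (e + 1)) ℂ)))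
      = Subfield.closure
        ((algebraMap (MvPolynomial (Fin (e + 1)) ℂ)
            (FractionRing (MvPolynomial (Fin (e + 1)) ℂ))) ''
          (Ve e : Set (MvPolynomial (Fin (e + 1)) ℂ))))
    ∧
    -- (iii) `V_e` is integrally closed in its field of fractions;
    IsIntegrallyClosed ↥(Ve e)
    ∧
    -- in particular `V_e` is a finite `Q_e`-module (of generic rank `1`, by (ii)):
    (∃ s : Finset (MvPolynomial (Fin (e + 1)) ℂ),
      (↑s : Set (MvPolynomial (Fin (e + 1)) ℂ)) ⊆ (Ve e : Set (MvPolynomial (Fin (e + 1)) ℂ))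
      ∧ (Ve e : Set (MvPolynomial (Fin (e + 1)) ℂ)) ⊆
          (Submodule.span ↥(Qe e) (↑s : Set (MvPolynomial (Fin (e + 1)) ℂ)) :
            Submodule ↥(Qe e) (MvPolynomial (Fin (e + 1)) ℂ))) := by
  refine ⟨fun x _ => isIntegral_Qe e x, subfieldClosure_Qe_eq e, isIntegrallyClosed_Ve e,
    exists_finset_span_Ve e⟩

end
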